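/- Let τ ∈ iℝ_{>0} and set t = e^{−πτi/3} θ'(0,3τ)/(4i θ(πτ,3τ) + 6 θ'(πτ,3τ)). Define X(z) = e^{−4πτi/3} θ(z,3τ) θ(z−πτ,3τ)/(θ(z+πτ,3τ) θ(z−2πτ,3τ)) and Y(z) = X(z+πτ). Then for every z ∈ ℂ at which X(z) and Y(z) are defined and nonzero, 1 − t·X(z)·Y(z) − t/X(z) − t/Y(z) = 0. -/

import Mathlib

open scoped BigOperators
noncomputable section

abbrev WSt : Type := ℤ × ℕ × ℕ

def cellStep (v w : WSt) : Prop :=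
  w = (v.1, v.2.1 + 1, v.2.2 + 1) ∨
  (1 ≤ v.2.2 ∧ w = (v.1, v.2.1, v.2.2 - 1)) ∨
  (1 ≤ v.2.1 ∧ w = (v.1, v.2.1 - 1, v.2.2)) ∨
  (v.2.1 = 0 ∧ w = (v.1 + 1, v.2.2, 0)) ∨
  (v.2.2 = 0 ∧ w = (v.1 - 1, 0, v.2.1 + 1))

def vertStep (v w : WSt) : Prop :=
  w = (v.1, v.2.1 + 1, v.2.2 + 1) ∨
  (1 ≤ v.2.2 ∧ w = (v.1, v.2.1, v.2.2 - 1)) ∨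
  (1 ≤ v.2.1 ∧ w = (v.1, v.2.1 - 1, v.2.2)) ∨
  (v.2.1 = 0 ∧ 1 ≤ v.2.2 ∧ w = (v.1 + 1, v.2.2 - 1, 0)) ∨
  (v.2.2 = 0 ∧ w = (v.1 - 1, 0, v.2.1 + 2))

def pathCount (step : WSt → WSt → Prop) (n : ℕ) (v : WSt) : ℕ :=
  Nat.card {p : Fin (n + 1) → WSt //
    p 0 = ((0 : ℤ), 0, 0) ∧ p (Fin.last n) = v ∧
    ∀ i : Fin n, step (p i.castSucc) (p i.succ)}

/-- number of cell-centred excursions of length `n` with winding angle `2πk/3` -/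
def eCell (n : ℕ) (k : ℤ) : ℕ := pathCount cellStep n (k, 0, 0)

/-- number of vertex-centred walks of length `n` with winding angle `2πk/3` -/
def eVert (n : ℕ) (k : ℤ) : ℕ := pathCount vertStep n (k, 0, 0)

/-- The series `T_k(u,q)`. -/
def Tk (k : ℕ) (u q : ℂ) : ℂ :=
  ∑' n : ℕ, (-1 : ℂ) ^ n * ((2 * n + 1 : ℕ) : ℂ) ^ k * q ^ (n * (n + 1) / 2) *
    (u ^ (n + 1) - (-1 : ℂ) ^ k * u ^ (-(n : ℤ)))

/-- Jacobi theta function θ₁₁. -/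
def jTheta (z τ : ℂ) : ℂ :=
  ∑' n : ℤ, (-1 : ℂ) ^ n *
    Complex.exp (((2 * (n : ℂ) + 1) / 2) ^ 2 * Complex.I * (Real.pi : ℂ) * τ +
      (2 * (n : ℂ) + 1) * Complex.I * z)

/-- derivative of θ with respect to z -/
def jTheta' (z τ : ℂ) : ℂ := deriv (fun w => jTheta w τ) z

/-- parameterising function X(z) for the Kreweras kernel -/
def Xfun (τ z : ℂ) : ℂ :=
  Complex.exp (-(4 * (Real.pi : ℂ) * τ * Complex.I) / 3) *
    (jTheta z (3 * τ) * jTheta (z - Real.pi * τ) (3 * τ)) /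
    (jTheta (z + Real.pi * τ) (3 * τ) * jTheta (z - 2 * Real.pi * τ) (3 * τ))

section ThetaNonvanishing

open Complex
open scoped Real

lemma jTheta_eq_jacobiTheta₂ (z T : ℂ) :
    jTheta z T = exp (π * I * T / 4 + I * z) * jacobiTheta₂ (z / π + (T + 1) / 2) T := by
  have hπ : (π : ℂ) ≠ 0 := by exact_mod_cast Real.pi_ne_zero
  rw [jTheta, jacobiTheta₂, ← tsum_mul_left]
  refine tsum_congr fun n ↦ ?_
  rw [jacobiTheta₂_term, ← exp_pi_mul_I, ← exp_int_mul, ← exp_add, ← exp_add]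
  congr 1
  field_simp
  ring

lemma jacobiTheta₂_half_eq_zero (T : ℂ) : jacobiTheta₂ ((T + 1) / 2) T = 0 := by
  have h := jacobiTheta₂_add_left' ((1 - T) / 2) T
  have e : jacobiTheta₂ ((1 - T) / 2) T = jacobiTheta₂ ((T + 1) / 2) T := by
    rw [← jacobiTheta₂_neg_left, ← jacobiTheta₂_add_left]
    ring_nf
  rw [e, show (1 - T) / 2 + T = (T + 1) / 2 by ring,
    show -π * I * (T + 2 * ((1 - T) / 2)) = -(π * I) by ring, exp_neg, exp_pi_mul_I] at h
  norm_num at h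
  linear_combination h / 2

lemma hasSum_jacobiTheta₂'_half {y : ℝ} (hy : 0 < y) :
    HasSum (fun n : ℕ ↦ 2 * π * I *
        ((-1) ^ n * (2 * n + 1) * (Real.exp (-π * y) : ℂ) ^ (n * (n + 1))))
      (jacobiTheta₂' ((I * y + 1) / 2) (I * y)) := by
  have h := (hasSum_jacobiTheta₂'_term ((I * y + 1) / 2) (τ := I * y)
    (by simpa using hy)).nat_add_neg_add_one
  convert h using 2 with n
  have hodd : exp (-(2 * n + 1) * (π * I)) = -1 := by
    rw [show -(2 * n + 1) * (π * I) = ((-(n + 1) : ℤ) : ℂ) * (2 * π * I) + π * I by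
      push_cast; ring, exp_add, exp_int_mul_two_pi_mul_I, exp_pi_mul_I, one_mul]
  have hpos : jacobiTheta₂_term n ((I * y + 1) / 2) (I * y)
      = (-1) ^ n * (Real.exp (-π * y) : ℂ) ^ (n * (n + 1)) := by
    rw [jacobiTheta₂_term, ofReal_exp, ← exp_nat_mul, ← exp_pi_mul_I, ← exp_nat_mul, ← exp_add]
    congr 1
    push_cast
    linear_combination (π * y * (n * (n + 1)) : ℂ) * I_sq
  have hneg : jacobiTheta₂_term (-(n + 1 : ℤ)) ((I * y + 1) / 2) (I * y)
      = -jacobiTheta₂_term n ((I * y + 1) / 2) (I * y) := by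
    rw [← neg_one_mul (jacobiTheta₂_term _ _ _), ← hodd, jacobiTheta₂_term, jacobiTheta₂_term,
      ← exp_add]
    congr 1
    push_cast
    ring
  rw [jacobiTheta₂'_term, jacobiTheta₂'_term, hneg, hpos]
  push_cast
  ring

lemma jacobiTheta₂'_half_ne_zero_of_one_le {y : ℝ} (hy : 1 ≤ y) :
    jacobiTheta₂' ((I * y + 1) / 2) (I * y) ≠ 0 := by
  intro h0
  have h := hasSum_jacobiTheta₂'_half (zero_lt_one.trans_le hy)
  rw [h0] at h
  have hq0 : 0 < Real.exp (-π * y) := Real.exp_pos _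
  have hq : Real.exp (-π * y) ≤ 1 / 4 := by
    rw [neg_mul, Real.exp_neg, one_div]
    refine inv_anti₀ (by norm_num) ?_
    have := Real.add_one_le_exp (π * y)
    nlinarith [Real.pi_gt_three]
  set q := Real.exp (-π * y)
  have h2 := (h.mul_left ((2 * π * I : ℂ)⁻¹))
  simp only [inv_mul_cancel_left₀ two_pi_I_ne_zero, mul_zero] at h2
  rw [← hasSum_nat_add_iff' 1] at h2
  have hb : ∀ n : ℕ, ‖(-1 : ℂ) ^ (n + 1) * (2 * (n + 1 : ℕ) + 1) *
      (q : ℂ) ^ ((n + 1) * (n + 1 + 1))‖ ≤ 1 / 4 * (1 / 4) ^ n := by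
    intro n
    have e : ‖(2 * (n + 1 : ℕ) + 1 : ℂ)‖ = 2 * (n + 1 : ℕ) + 1 := by
      rw [show (2 * (n + 1 : ℕ) + 1 : ℂ) = ((2 * (n + 1 : ℕ) + 1 : ℝ) : ℂ) by push_cast; ring,
        norm_real, Real.norm_of_nonneg (by positivity)]
    rw [norm_mul, norm_mul, norm_pow, norm_neg, norm_one, one_pow, one_mul, norm_pow, norm_real,
      Real.norm_of_nonneg hq0.le, e]
    have h3 : (2 * (n + 1 : ℕ) + 1 : ℝ) ≤ 3 ^ (n + 1) := by
      have := one_add_mul_le_pow (a := (2 : ℝ)) (by norm_num) (n + 1)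
      norm_num at this ⊢
      linarith
    have h4 : q ^ ((n + 1) * (n + 1 + 1)) ≤ (1 / 16) ^ (n + 1) := calc
      _ ≤ q ^ (2 * (n + 1)) := pow_le_pow_of_le_one hq0.le (by linarith) (by nlinarith)
      _ ≤ (1 / 4) ^ (2 * (n + 1)) := pow_le_pow_left₀ hq0.le hq _
      _ = _ := by rw [pow_mul]; norm_num
    calc _ ≤ (3 : ℝ) ^ (n + 1) * (1 / 16) ^ (n + 1) := by gcongr
      _ = (3 / 16) ^ (n + 1) := by rw [← mul_pow]; norm_num
      _ ≤ (1 / 4) ^ (n + 1) := 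
        pow_le_pow_left₀ (by norm_num) (by norm_num) _
      _ = _ := pow_succ' _ _
  have := h2.norm_le_of_bounded
    ((hasSum_geometric_of_lt_one (by norm_num) (by norm_num)).mul_left (1 / 4 : ℝ)) hb
  norm_num at this

lemma jacobiTheta₂'_half_ne_zero {y : ℝ} (hy : 0 < y) :
    jacobiTheta₂' ((I * y + 1) / 2) (I * y) ≠ 0 := by
  rcases le_total 1 y with h1 | h1
  · exact jacobiTheta₂'_half_ne_zero_of_one_le h1
  have hy' : (y : ℂ) ≠ 0 := by exact_mod_cast hy.ne'
  have hI := I_ne_zero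
  have hinv := jacobiTheta₂'_half_ne_zero_of_one_le ((one_le_inv₀ hy).2 h1)
  have e1 : -1 / (I * y) = I * (y⁻¹ : ℝ) := by
    push_cast
    field_simp
    simp
  have e2 : (I * y + 1) / 2 / (I * y) = -((I * (y⁻¹ : ℝ) + 1) / 2) + 1 := by
    rw [← e1]; field_simp; ring
  rw [jacobiTheta₂'_functional_equation, e1, e2, jacobiTheta₂'_add_left, jacobiTheta₂_add_left,
    jacobiTheta₂'_neg_left, jacobiTheta₂_neg_left, jacobiTheta₂_half_eq_zero]
  simp only [mul_zero, sub_zero]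
  refine mul_ne_zero (div_ne_zero (mul_ne_zero (one_div_ne_zero ?_) (exp_ne_zero _)) ?_)
    (neg_ne_zero.2 hinv)
  · simp [cpow_eq_zero_iff, hy']
  · simp [hy']

lemma differentiable_jTheta {T : ℂ} (hT : 0 < T.im) : Differentiable ℂ (jTheta · T) := by
  simp_rw [jTheta_eq_jacobiTheta₂]
  intro z
  have := (differentiableAt_jacobiTheta₂_fst (z / π + (T + 1) / 2) hT).comp z
    (f := fun z : ℂ ↦ z / π + (T + 1) / 2) (by fun_prop)
  exact (by fun_prop : DifferentiableAt ℂ (fun z ↦ exp (π * I * T / 4 + I * z)) z).mul this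

lemma hasDerivAt_jTheta {T : ℂ} (hT : 0 < T.im) (z : ℂ) :
    HasDerivAt (jTheta · T) (jTheta' z T) z :=
  (differentiable_jTheta hT z).hasDerivAt

lemma jTheta'_zero_ne_zero {y : ℝ} (hy : 0 < y) : jTheta' 0 (I * y) ≠ 0 := by
  have hT : 0 < (I * y).im := by simpa using hy
  have hθ : HasDerivAt (fun z : ℂ ↦ jacobiTheta₂ (z / π + (I * y + 1) / 2) (I * y))
      (jacobiTheta₂' ((I * y + 1) / 2) (I * y) * (1 / π)) 0 := by
    have h1 : HasDerivAt (fun z : ℂ ↦ z / π + (I * y + 1) / 2) (1 / π : ℂ) 0 :=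
      ((hasDerivAt_id _).div_const _).add_const _
    refine HasDerivAt.comp (0 : ℂ) (h₂ := (jacobiTheta₂ · (I * y))) ?_ h1
    simpa using hasDerivAt_jacobiTheta₂_fst ((I * y + 1) / 2) hT
  have hE : HasDerivAt (fun z : ℂ ↦ exp (π * I * (I * y) / 4 + I * z))
      (deriv (fun z : ℂ ↦ exp (π * I * (I * y) / 4 + I * z)) 0) 0 :=
    (by fun_prop : DifferentiableAt ℂ (fun z ↦ exp (π * I * (I * y) / 4 + I * z)) 0).hasDerivAt
  have := hE.mul hθ
  rw [jTheta', funext fun z ↦ jTheta_eq_jacobiTheta₂ z (I * y)]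
  rw [show (fun z : ℂ ↦ exp (π * I * (I * y) / 4 + I * z) *
    jacobiTheta₂ (z / π + (I * y + 1) / 2) (I * y)) = _ * _ from rfl, this.deriv]
  simp only [zero_div, zero_add, jacobiTheta₂_half_eq_zero, mul_zero]
  refine mul_ne_zero (exp_ne_zero _) (mul_ne_zero (jacobiTheta₂'_half_ne_zero hy) ?_)
  simp [Real.pi_ne_zero]

lemma jTheta_neg (z T : ℂ) : jTheta (-z) T = -jTheta z T := by
  rw [jTheta, jTheta, ← tsum_neg, ← (Equiv.subLeft (-1 : ℤ)).tsum_eq]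
  refine tsum_congr fun n ↦ ?_
  have h : (-1 : ℂ) ^ (-1 - n) = -(-1) ^ n := by
    rw [zpow_sub₀ (by norm_num)]
    rcases Int.even_or_odd n with hn | hn <;> simp [hn.neg_one_zpow]
  rw [Equiv.subLeft_apply, h, neg_mul]
  congr 3
  push_cast
  ring

lemma jTheta_add_pi (z T : ℂ) : jTheta (z + π) T = -jTheta z T := by
  have hπ : (π : ℂ) ≠ 0 := by exact_mod_cast Real.pi_ne_zero
  rw [jTheta_eq_jacobiTheta₂, jTheta_eq_jacobiTheta₂ z,
    show (z + π) / π + (T + 1) / 2 = z / π + (T + 1) / 2 + 1 by field_simp; ring,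
    jacobiTheta₂_add_left, show π * I * T / 4 + I * (z + π) = π * I * T / 4 + I * z + π * I by ring,
    exp_add _ (π * I), exp_pi_mul_I]
  ring

lemma jTheta_add_pi_mul (z T : ℂ) :
    jTheta (z + π * T) T = -exp (-π * I * T - 2 * I * z) * jTheta z T := by
  have hπ : (π : ℂ) ≠ 0 := by exact_mod_cast Real.pi_ne_zero
  rw [jTheta_eq_jacobiTheta₂, jTheta_eq_jacobiTheta₂ z,
    show (z + π * T) / π + (T + 1) / 2 = z / π + (T + 1) / 2 + T by field_simp; ring,
    jacobiTheta₂_add_left', ← mul_assoc, ← mul_assoc, ← neg_one_mul (exp _), ← exp_pi_mul_I,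
    ← exp_add, ← exp_add, ← exp_add]
  congr 1
  rw [exp_eq_exp_iff_exists_int]
  refine ⟨-1, ?_⟩
  field_simp
  push_cast
  ring

lemma jTheta_pi_div_two_add (s : ℝ) {y : ℝ} (hy : 0 < y) :
    ∃ r : ℝ, 0 < r ∧ jTheta (π / 2 + I * s) (I * y) = I * r := by
  have hπ : (π : ℂ) ≠ 0 := by exact_mod_cast Real.pi_ne_zero
  let g : ℤ → ℝ := fun n ↦ Real.exp (-(π * n ^ 2 * y) - 2 * π * n * (s / π + y / 2))
  have hT : 0 < (I * y).im := by simpa using hy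
  have h := hasSum_jacobiTheta₂_term (I * s / π + I * y / 2) hT
  have hg : ∀ n, jacobiTheta₂_term n (I * s / π + I * y / 2) (I * y) = (g n : ℂ) := fun n ↦ by
    simp only [jacobiTheta₂_term, g, ofReal_exp]
    congr 1
    push_cast
    linear_combination (2 * π * n * (s / π + y / 2) + π * n ^ 2 * y) * I_sq
  simp_rw [hg] at h
  have hgs : Summable g := by exact_mod_cast h.summable
  refine ⟨Real.exp (-(π * y / 4) - s) * ∑' n, g n,
    mul_pos (Real.exp_pos _) (hgs.tsum_pos (fun n ↦ (Real.exp_pos _).le) 0 (Real.exp_pos _)), ?_⟩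
  rw [jTheta_eq_jacobiTheta₂, show (π / 2 + I * s) / π + (I * y + 1) / 2
    = I * s / π + I * y / 2 + 1 by field_simp; ring, jacobiTheta₂_add_left, ← h.tsum_eq,
    ofReal_mul, ofReal_tsum, ofReal_exp,
    show π * I * (I * y) / 4 + I * (π / 2 + I * s) = ((-(π * y / 4) - s : ℝ) : ℂ) + π / 2 * I by
      push_cast; linear_combination (π * y / 4 + s) * I_sq, exp_add, exp_pi_div_two_mul_I]
  ring

end ThetaNonvanishing

section QuasiPeriodic

open Complex MeasureTheory
open scoped Real Interval

lemma integral_eq_integral_add_mul_I {g : ℂ → ℂ} (hg : Differentiable ℂ g)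
    (hp : ∀ z, g (z + π) = g z) (b : ℝ) :
    ∫ x : ℝ in 0..π, g x = ∫ x : ℝ in 0..π, g (x + b * I) := by
  have h := integral_boundary_rect_eq_zero_of_differentiableOn g 0 (π + b * I)
    hg.differentiableOn
  simp only [zero_re, zero_im, add_re, ofReal_re, mul_re, I_re, mul_zero, ofReal_im, I_im, mul_one,
    sub_self, add_zero, add_im, mul_im, zero_add, ofReal_zero, zero_mul] at h
  have e : ∀ x : ℝ, g (π + x * I) = g (x * I) := fun x ↦ by rw [add_comm, hp]
  simp_rw [e] at h
  linear_combination h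

lemma eq_zero_of_integral_exp_eq_zero {g : ℂ → ℂ} (hg : Differentiable ℂ g)
    (hp : ∀ z, g (z + π) = g z)
    (h0 : ∀ k : ℤ, ∫ x : ℝ in 0..π, g x * exp (-(2 * k) * I * x) = 0) : g = 0 := by
  have : Fact (0 < π) := ⟨Real.pi_pos⟩
  have hπ : (π : ℂ) ≠ 0 := by exact_mod_cast Real.pi_ne_zero
  have hper : Function.Periodic (fun x : ℝ ↦ g x) π := fun x ↦ by simp [hp]
  have hcont : Continuous hper.lift :=
    continuous_quot_lift _ (hg.continuous.comp continuous_ofReal)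
  let f : C(AddCircle π, ℂ) := ⟨hper.lift, hcont⟩
  have hf : fourierCoeff f = 0 := by
    funext k
    rw [fourierCoeff_eq_intervalIntegral _ _ 0, zero_add, Pi.zero_apply, ← smul_zero (1 / π : ℝ) (A := ℂ),
      ← h0 k]
    congr 1
    refine intervalIntegral.integral_congr fun x _ ↦ ?_
    change fourier (-k) (x : AddCircle π) • g x = _
    rw [fourier_coe_apply, smul_eq_mul, mul_comm]
    congr 2
    field_simp
    push_cast
    ring
  have hR : ∀ x : ℝ, g x = 0 := fun x ↦ by
    have := has_pointwise_sum_fourier_series_of_summable (f := f) (by rw [hf]; exact summable_zero)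
      (x : AddCircle π)
    simp only [hf, Pi.zero_apply, zero_smul] at this
    exact this.unique hasSum_zero
  refine AnalyticOnNhd.eq_of_frequently_eq (z₀ := 0)
    (hg.differentiableOn.analyticOnNhd isOpen_univ) analyticOnNhd_const ?_
  have ht : Filter.Tendsto (fun x : ℝ ↦ (x : ℂ)) (nhdsWithin 0 {0}ᶜ) (nhdsWithin 0 {0}ᶜ) := by
    refine tendsto_nhdsWithin_iff.2 ⟨?_, ?_⟩
    · exact (continuous_ofReal.tendsto' 0 0 ofReal_zero).mono_left nhdsWithin_le_nhds
    · filter_upwards [self_mem_nhdsWithin] with x hx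
      simpa using hx
  exact ht.frequently (Filter.Eventually.of_forall hR).frequently

/-- Entire functions with the quasi-periodicity of the theta function `jTheta · τ`. -/
structure IsThetaLike (τ : ℂ) (h : ℂ → ℂ) : Prop where
  differentiable : Differentiable ℂ h
  add_pi : ∀ z, h (z + π) = -h z
  add_pi_mul : ∀ z, h (z + π * τ) = -exp (-π * I * τ - 2 * I * z) * h z

/-- The coefficient of `exp (I z)` in the Fourier expansion of a theta-like function. -/
def thetaCoeff (h : ℂ → ℂ) : ℂ := ∫ x : ℝ in 0..π, h x * exp (-I * x)

lemma IsThetaLike.eq_zero {y : ℝ} {h : ℂ → ℂ} (hh : IsThetaLike (I * y) h)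
    (h0 : thetaCoeff h = 0) : h = 0 := by
  let g : ℂ → ℂ := fun z ↦ h z * exp (-I * z)
  have hg : Differentiable ℂ g := hh.differentiable.mul (by fun_prop)
  have hp : ∀ z, g (z + π) = g z := fun z ↦ by
    simp only [g, hh.add_pi]
    rw [show -I * (z + π) = -I * z + -(π * I) by ring, exp_add, exp_neg (π * I), exp_pi_mul_I]
    norm_num
  let d : ℤ → ℂ := fun k ↦ ∫ x : ℝ in 0..π, g x * exp (-(2 * k) * I * x)
  have hrec : ∀ k : ℤ, d k = -exp (-(2 * (k + 1)) * I * (π * (I * y))) * d (k + 1) := by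
    intro k
    have hk : Differentiable ℂ fun z ↦ g z * exp (-(2 * k) * I * z) := hg.mul (by fun_prop)
    have hkp : ∀ z, g (z + π) * exp (-(2 * k) * I * (z + π)) = g z * exp (-(2 * k) * I * z) := by
      intro z
      rw [hp, show -(2 * k) * I * (z + π) = -(2 * k) * I * z + ((-k : ℤ) : ℂ) * (2 * π * I) by
        push_cast; ring, exp_add, exp_int_mul_two_pi_mul_I, mul_one]
    have := integral_eq_integral_add_mul_I hk hkp (π * y)
    simp only [d]
    rw [this, ← intervalIntegral.integral_const_mul]
    refine intervalIntegral.integral_congr fun x _ ↦ ?_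
    simp only [g]
    rw [show (x + ((π * y : ℝ) : ℂ) * I) = x + π * (I * y) by push_cast; ring, hh.add_pi_mul]
    have he : exp (-π * I * (I * y) - 2 * I * x) * exp (-I * (x + π * (I * y))) *
        exp (-(2 * k) * I * (x + π * (I * y))) = exp (-(2 * (k + 1)) * I * (π * (I * y))) *
          exp (-I * x) * exp (-(2 * (k + 1 : ℤ)) * I * x) := by
      simp only [← exp_add]
      congr 1
      push_cast
      ring
    linear_combination -h x * he
  have hd : ∀ k : ℤ, d k = 0 := by
    intro k
    induction k with
    | zero => simpa [d, g, thetaCoeff] using h0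
    | succ n ih =>
      have := hrec n
      rw [ih] at this
      simpa [exp_ne_zero] using this.symm
    | pred n ih =>
      rw [hrec, sub_add_cancel, ih, mul_zero]
  have hg0 := eq_zero_of_integral_exp_eq_zero hg hp hd
  ext z
  simpa [g, exp_ne_zero] using congrFun hg0 z

lemma IsThetaLike.exists_eq_mul {y : ℝ} {h₁ h₂ : ℂ → ℂ} (hh₁ : IsThetaLike (I * y) h₁)
    (hh₂ : IsThetaLike (I * y) h₂) {w : ℂ} (hw₁ : h₁ w ≠ 0) (hw₂ : h₂ w ≠ 0) :
    ∃ c : ℂ, c ≠ 0 ∧ ∀ z, h₁ z = c * h₂ z := by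
  have hlin : ∀ a b : ℂ, IsThetaLike (I * y) fun z ↦ a * h₁ z - b * h₂ z := fun a b ↦
    { differentiable := (hh₁.differentiable.const_mul a).sub (hh₂.differentiable.const_mul b)
      add_pi := fun z ↦ by rw [hh₁.add_pi, hh₂.add_pi]; ring
      add_pi_mul := fun z ↦ by rw [hh₁.add_pi_mul, hh₂.add_pi_mul]; ring }
  have hint : ∀ {h : ℂ → ℂ}, Differentiable ℂ h → IntervalIntegrable
      (fun x : ℝ ↦ h x * exp (-I * x)) volume 0 π := fun {h} hd ↦ by
    have := hd.continuous
    exact Continuous.intervalIntegrable (by fun_prop) _ _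
  have hcoeff : thetaCoeff (fun z ↦ thetaCoeff h₂ * h₁ z - thetaCoeff h₁ * h₂ z) = 0 := by
    simp only [thetaCoeff, sub_mul, mul_assoc]
    rw [intervalIntegral.integral_sub ((hint hh₁.differentiable).const_mul _)
      ((hint hh₂.differentiable).const_mul _)]
    simp only [intervalIntegral.integral_const_mul]
    ring
  have hne : ∀ {h : ℂ → ℂ}, IsThetaLike (I * y) h → h w ≠ 0 → thetaCoeff h ≠ 0 :=
    fun hh hw h0 ↦ hw (by rw [hh.eq_zero h0]; rfl)
  have h1 := hne hh₁ hw₁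
  have h2 := hne hh₂ hw₂
  refine ⟨thetaCoeff h₁ / thetaCoeff h₂, div_ne_zero h1 h2, fun z ↦ ?_⟩
  have := congrFun ((hlin _ _).eq_zero hcoeff) z
  simp only [Pi.zero_apply] at this
  field_simp
  linear_combination this

end QuasiPeriodic

section KernelIdentity

open Complex
open scoped Real

lemma isThetaLike_jTheta {y : ℝ} (hy : 0 < y) : IsThetaLike (I * y) (jTheta · (I * y)) where
  differentiable := differentiable_jTheta (by simpa using hy)
  add_pi z := jTheta_add_pi z _
  add_pi_mul z := jTheta_add_pi_mul z _

lemma jTheta_add_two_mul (z τ : ℂ) : jTheta (z + 2 * π * τ) (3 * τ) =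
    -exp (-π * I * τ - 2 * I * z) * jTheta (z - π * τ) (3 * τ) := by
  have := jTheta_add_pi_mul (z - π * τ) (3 * τ)
  rw [show z - π * τ + π * (3 * τ) = z + 2 * π * τ by ring] at this
  rw [this]
  ring_nf

lemma jTheta_sub_two_mul (z τ : ℂ) : jTheta (z - 2 * π * τ) (3 * τ) =
    -exp (2 * I * z - π * I * τ) * jTheta (z + π * τ) (3 * τ) := by
  have := jTheta_add_two_mul (-z) τ
  rw [show -z + 2 * π * τ = -(z - 2 * π * τ) by ring, show -z - π * τ = -(z + π * τ) by ring,
    jTheta_neg, jTheta_neg] at this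
  rw [← neg_inj, this]
  ring_nf

/-- The product of the three translates of `jTheta · (3 * τ)` by multiples of `π * τ`. -/
def thetaProd (τ z : ℂ) : ℂ :=
  jTheta z (3 * τ) * jTheta (z + π * τ) (3 * τ) * jTheta (z - π * τ) (3 * τ)

/-- The combination of cubes of translates of `jTheta · (3 * τ)` proportional to `thetaProd τ`. -/
def thetaCubes (τ z : ℂ) : ℂ :=
  exp (-π * I * τ) * jTheta z (3 * τ) ^ 3 - exp (2 * I * z) * jTheta (z + π * τ) (3 * τ) ^ 3 -
    exp (-2 * I * z) * jTheta (z - π * τ) (3 * τ) ^ 3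

lemma isThetaLike_thetaProd {y : ℝ} (hy : 0 < y) :
    IsThetaLike (I * y) (thetaProd (I * y)) where
  differentiable := by
    have hd := differentiable_jTheta (T := 3 * (I * y)) (by simpa using hy)
    exact (hd.mul (hd.comp (differentiable_id.add_const _))).mul
      (hd.comp (differentiable_id.sub_const _))
  add_pi z := by
    simp only [thetaProd]
    rw [add_right_comm, add_sub_right_comm, jTheta_add_pi, jTheta_add_pi, jTheta_add_pi]
    ring
  add_pi_mul z := by
    simp only [thetaProd]
    rw [add_assoc, ← two_mul, ← mul_assoc 2, jTheta_add_two_mul, add_sub_cancel_right]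
    ring

lemma isThetaLike_thetaCubes {y : ℝ} (hy : 0 < y) :
    IsThetaLike (I * y) (thetaCubes (I * y)) where
  differentiable := by
    have hd := differentiable_jTheta (T := 3 * (I * y)) (by simpa using hy)
    have h1 := hd.comp (differentiable_id.add_const (π * (I * y)))
    have h2 := hd.comp (differentiable_id.sub_const (π * (I * y)))
    exact (((hd.pow 3).const_mul _).sub
      ((by fun_prop : Differentiable ℂ fun z ↦ exp (2 * I * z)).mul (h1.pow 3))).sub
      ((by fun_prop : Differentiable ℂ fun z ↦ exp (-2 * I * z)).mul (h2.pow 3))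
  add_pi z := by
    simp only [thetaCubes]
    rw [add_right_comm, add_sub_right_comm, jTheta_add_pi, jTheta_add_pi, jTheta_add_pi,
      show 2 * I * (z + π) = 2 * I * z + 2 * π * I by ring,
      show -2 * I * (z + π) = -2 * I * z - 2 * π * I by ring,
      exp_add, exp_sub, exp_two_pi_mul_I]
    ring
  add_pi_mul z := by
    simp only [thetaCubes]
    rw [add_assoc, ← two_mul, ← mul_assoc 2, jTheta_add_two_mul, add_sub_cancel_right]
    set τ := I * (y : ℂ)
    have e1 : exp (2 * I * (z + π * τ)) * exp (-π * I * τ - 2 * I * z) ^ 3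
        = exp (-π * I * τ - 2 * I * z) * exp (-2 * I * z) := by
      rw [← exp_nat_mul, ← exp_add, ← exp_add]; congr 1; push_cast; ring
    have e2 : exp (-2 * I * (z + π * τ)) = exp (-π * I * τ - 2 * I * z) * exp (-π * I * τ) := by
      rw [← exp_add]; congr 1; ring
    have e3 : exp (-π * I * τ) = exp (-π * I * τ - 2 * I * z) * exp (2 * I * z) := by
      rw [← exp_add]; congr 1; ring
    rw [e2]
    linear_combination jTheta (z - π * τ) (3 * τ) ^ 3 * e1 + jTheta (z + π * τ) (3 * τ) ^ 3 * e3

lemma jTheta'_neg {T : ℂ} (hT : 0 < T.im) (z : ℂ) : jTheta' (-z) T = jTheta' z T := by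
  have h1 : HasDerivAt (fun w ↦ jTheta (-w) T) (jTheta' (-z) T * -1) z :=
    (hasDerivAt_jTheta hT (-z)).comp z (hasDerivAt_neg z)
  simp_rw [jTheta_neg] at h1
  have := h1.unique (hasDerivAt_jTheta hT z).neg
  linear_combination -this

lemma jTheta_zero (T : ℂ) : jTheta 0 T = 0 := by
  have := jTheta_neg 0 T
  rw [neg_zero] at this
  linear_combination this / 2

lemma hasDerivAt_jTheta_add {T : ℂ} (hT : 0 < T.im) (a : ℂ) :
    HasDerivAt (fun z ↦ jTheta (z + a) T) (jTheta' a T) 0 := by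
  have := hasDerivAt_jTheta hT a
  rw [← zero_add a] at this
  simpa using this.comp_add_const 0 a

lemma hasDerivAt_jTheta_sub {T : ℂ} (hT : 0 < T.im) (a : ℂ) :
    HasDerivAt (fun z ↦ jTheta (z - a) T) (jTheta' a T) 0 := by
  simpa [sub_eq_add_neg, jTheta'_neg hT] using hasDerivAt_jTheta_add hT (-a)

lemma hasDerivAt_thetaProd {τ : ℂ} (hτ : 0 < (3 * τ).im) :
    HasDerivAt (thetaProd τ) (-jTheta' 0 (3 * τ) * jTheta (π * τ) (3 * τ) ^ 2) 0 := by
  refine (((hasDerivAt_jTheta hτ 0).mul (hasDerivAt_jTheta_add hτ (π * τ))).mul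
    (hasDerivAt_jTheta_sub hτ (π * τ))).congr_deriv ?_
  simp only [Pi.mul_apply, zero_add, zero_sub, jTheta_neg, jTheta_zero]
  ring

lemma hasDerivAt_thetaCubes {τ : ℂ} (hτ : 0 < (3 * τ).im) :
    HasDerivAt (thetaCubes τ) (-jTheta (π * τ) (3 * τ) ^ 2 *
      (4 * I * jTheta (π * τ) (3 * τ) + 6 * jTheta' (π * τ) (3 * τ))) 0 := by
  have he : ∀ c : ℂ, HasDerivAt (fun z ↦ exp (c * z)) c 0 := fun c ↦ by
    simpa using ((hasDerivAt_id (0 : ℂ)).const_mul c).cexp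
  refine (((((hasDerivAt_jTheta hτ 0).pow 3).const_mul _).sub
    ((he (2 * I)).mul ((hasDerivAt_jTheta_add hτ (π * τ)).pow 3))).sub
    ((he (-2 * I)).mul ((hasDerivAt_jTheta_sub hτ (π * τ)).pow 3))).congr_deriv ?_
  simp only [Pi.pow_apply, zero_add, zero_sub, jTheta_neg, jTheta_zero, mul_zero, exp_zero]
  push_cast
  ring

lemma thetaProd_thetaCubes_pi_div_two_ne_zero {y : ℝ} (hy : 0 < y) :
    thetaProd (I * y) (π / 2) ≠ 0 ∧ thetaCubes (I * y) (π / 2) ≠ 0 := by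
  obtain ⟨a, ha, hA⟩ := jTheta_pi_div_two_add 0 (show 0 < 3 * y by positivity)
  obtain ⟨b, hb, hB⟩ := jTheta_pi_div_two_add (π * y) (show 0 < 3 * y by positivity)
  obtain ⟨c, hc, hC⟩ := jTheta_pi_div_two_add (-(π * y)) (show 0 < 3 * y by positivity)
  have eT : I * ((3 * y : ℝ) : ℂ) = 3 * (I * y) := by push_cast; ring
  rw [eT] at hA hB hC
  rw [show (π : ℂ) / 2 + I * (0 : ℝ) = π / 2 by simp] at hA
  rw [show (π : ℂ) / 2 + I * (π * y : ℝ) = π / 2 + π * (I * y) by push_cast; ring] at hB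
  rw [show (π : ℂ) / 2 + I * (-(π * y) : ℝ) = π / 2 - π * (I * y) by push_cast; ring] at hC
  constructor
  · rw [thetaProd, hA, hB, hC]
    simp [ha.ne', hb.ne', hc.ne']
  · have e1 : exp (-π * I * (I * y)) = (Real.exp (π * y) : ℂ) := by
      rw [ofReal_exp]; congr 1; push_cast; linear_combination -π * y * I_sq
    have e2 : exp (2 * I * (π / 2)) = -1 := by
      rw [← exp_pi_mul_I]; congr 1; ring
    have e3 : exp (-2 * I * (π / 2)) = -1 := by
      rw [neg_mul, neg_mul, exp_neg, e2]; norm_num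
    have hp : 0 < Real.exp (π * y) * a ^ 3 + b ^ 3 + c ^ 3 := by positivity
    have : thetaCubes (I * y) (π / 2)
        = -I * (Real.exp (π * y) * a ^ 3 + b ^ 3 + c ^ 3 : ℝ) := by
      rw [thetaCubes, hA, hB, hC, e1, e2, e3]
      push_cast
      linear_combination (exp (π * y) * a ^ 3 + b ^ 3 + c ^ 3 : ℂ) * I * I_sq
    rw [this]
    exact mul_ne_zero (neg_ne_zero.2 I_ne_zero) (by exact_mod_cast hp.ne')

lemma thetaProd_mul_eq_thetaCubes {y : ℝ} (hy : 0 < y) {τ : ℂ} (hτ : τ = I * y) :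
    4 * I * jTheta (π * τ) (3 * τ) + 6 * jTheta' (π * τ) (3 * τ) ≠ 0 ∧
    ∀ z, (4 * I * jTheta (π * τ) (3 * τ) + 6 * jTheta' (π * τ) (3 * τ)) * thetaProd τ z =
      jTheta' 0 (3 * τ) * thetaCubes τ z := by
  subst hτ
  have hτ : 0 < (I * y).im := by simpa using hy
  have hτ₃ : 0 < (3 * (I * y)).im := by simpa using hy
  obtain ⟨hP, hC⟩ := thetaProd_thetaCubes_pi_div_two_ne_zero hy
  have hΘ : jTheta (π / 2) (I * y) ≠ 0 := by
    obtain ⟨r, hr, h⟩ := jTheta_pi_div_two_add 0 hy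
    rw [ofReal_zero, mul_zero, add_zero] at h
    rw [h]
    simp [hr.ne']
  obtain ⟨p, hp, hpz⟩ := (isThetaLike_thetaProd hy).exists_eq_mul (isThetaLike_jTheta hy) hP hΘ
  obtain ⟨c, hc, hcz⟩ := (isThetaLike_thetaCubes hy).exists_eq_mul (isThetaLike_jTheta hy) hC hΘ
  have hdp := hasDerivAt_thetaProd hτ₃
  have hdc := hasDerivAt_thetaCubes hτ₃
  rw [funext hpz] at hdp
  rw [funext hcz] at hdc
  have h0 := hasDerivAt_jTheta hτ 0
  have ep := hdp.unique (h0.const_mul p)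
  have ec := hdc.unique (h0.const_mul c)
  have h1 := mul_ne_zero hp (jTheta'_zero_ne_zero hy)
  have h2 := mul_ne_zero hc (jTheta'_zero_ne_zero hy)
  rw [← ep] at h1
  rw [← ec] at h2
  have hθ : jTheta (π * (I * y)) (3 * (I * y)) ^ 2 ≠ 0 := right_ne_zero_of_mul h1
  refine ⟨right_ne_zero_of_mul h2, fun z ↦ mul_left_cancel₀ hθ ?_⟩
  rw [hpz, hcz]
  linear_combination (c * ep - p * ec) * jTheta z (I * y)

lemma Xfun_eq (τ z : ℂ) : Xfun τ z = -exp (-π * τ * I / 3) * exp (-2 * I * z) *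
    (jTheta z (3 * τ) * jTheta (z - π * τ) (3 * τ)) / jTheta (z + π * τ) (3 * τ) ^ 2 := by
  have e : exp (-(4 * π * τ * I) / 3) = exp (-π * τ * I / 3) * exp (-2 * I * z) *
      exp (2 * I * z - π * I * τ) := by
    rw [← exp_add, ← exp_add]; congr 1; ring
  rw [Xfun, jTheta_sub_two_mul, e]
  have := exp_ne_zero (2 * I * z - π * I * τ)
  field_simp

lemma Xfun_add_eq (τ z : ℂ) : Xfun τ (z + π * τ) = -exp (-π * τ * I / 3) * exp (2 * I * z) *
    (jTheta z (3 * τ) * jTheta (z + π * τ) (3 * τ)) / jTheta (z - π * τ) (3 * τ) ^ 2 := by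
  have e : exp (-(4 * π * τ * I) / 3) = exp (-π * τ * I / 3) * exp (2 * I * z) *
      exp (-π * I * τ - 2 * I * z) := by
    rw [← exp_add, ← exp_add]; congr 1; ring
  rw [Xfun, add_sub_cancel_right, show z + π * τ + π * τ = z + 2 * π * τ by ring,
    show z + π * τ - 2 * π * τ = z - π * τ by ring, jTheta_add_two_mul, e]
  have := exp_ne_zero (-π * I * τ - 2 * I * z)
  field_simp

end KernelIdentity

/-- Lemma 5: the kernel vanishes on the curve `(X(z), Y(z))`. -/
theorem kernel_parameterisation
    (y : ℝ) (hy : 0 < y) (τ : ℂ) (hτ : τ = Complex.I * y)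
    (t : ℂ)
    (ht : t = Complex.exp (-(Real.pi : ℂ) * τ * Complex.I / 3) * jTheta' 0 (3 * τ) /
        (4 * Complex.I * jTheta (Real.pi * τ) (3 * τ) + 6 * jTheta' (Real.pi * τ) (3 * τ)))
    (z : ℂ)
    (hden1 : jTheta (z + Real.pi * τ) (3 * τ) * jTheta (z - 2 * Real.pi * τ) (3 * τ) ≠ 0)
    (hden2 : jTheta (z + 2 * Real.pi * τ) (3 * τ) * jTheta (z - Real.pi * τ) (3 * τ) ≠ 0)
    (hX : Xfun τ z ≠ 0) (hY : Xfun τ (z + Real.pi * τ) ≠ 0) :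
    1 - t * Xfun τ z * Xfun τ (z + Real.pi * τ) - t / Xfun τ z -
      t / Xfun τ (z + Real.pi * τ) = 0 := by
  obtain ⟨hD, hker⟩ := thetaProd_mul_eq_thetaCubes hy hτ
  have hz := hker z
  have hB := left_ne_zero_of_mul hden1
  have hC := right_ne_zero_of_mul hden2
  have hA : jTheta z (3 * τ) ≠ 0 := by
    rintro h
    simp [Xfun, h] at hX
  have e3 : Complex.exp (-Real.pi * Complex.I * τ)
      = Complex.exp (-Real.pi * τ * Complex.I / 3) ^ 3 := by
    rw [← Complex.exp_nat_mul]
    congr 1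
    push_cast
    ring
  have ev : Complex.exp (-2 * Complex.I * z) = (Complex.exp (2 * Complex.I * z))⁻¹ := by
    rw [← Complex.exp_neg]
    congr 1
    ring
  rw [thetaProd, thetaCubes, e3, ev] at hz
  rw [Xfun_eq, Xfun_add_eq, ht, ev]
  have hp := Complex.exp_ne_zero (-Real.pi * τ * Complex.I / 3)
  have hv := Complex.exp_ne_zero (2 * Complex.I * z)
  generalize Complex.exp (-Real.pi * τ * Complex.I / 3) = p at *
  generalize Complex.exp (2 * Complex.I * z) = v at *
  generalize 4 * Complex.I * jTheta (Real.pi * τ) (3 * τ) +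
    6 * jTheta' (Real.pi * τ) (3 * τ) = D at *
  generalize jTheta (z + Real.pi * τ) (3 * τ) = B at *
  generalize jTheta (z - Real.pi * τ) (3 * τ) = C at *
  field_simp at hz ⊢
  linear_combination hz
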